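/- (Relationship of Taylor and Fourier–Hermite series.) Let g : ℝⁿ → ℝ be twice continuously differentiable with g, ∇g, and ∇²g continuous and of at most polynomial growth, let Λ be an invertible n×n real matrix, and fix y ∈ ℝⁿ. Define the Fourier–Hermite coefficients a = ∫ g(Λx + y) dγₙ(x), b = ∫ g(Λx + y)·x dγₙ(x), C = ∫ g(Λx + y)·(x xᵀ − I) dγₙ(x), and the second-order Fourier–Hermite expansion FH₂(y') = a − ½·tr(C) + bᵀ Λ^{−1}(y' − y) + ½ (y' − y)ᵀ Λ^{−⊤} C Λ^{−1} (y' − y). Define also the Weierstrass transform ḡ(w) = ∫ g(w + Λx) dγₙ(x) and its second-order Taylor expansion at y, T₂(y') = ḡ(y) + ∇ḡ(y)ᵀ(y' − y) + ½ (y' − y)ᵀ ∇²ḡ(y) (y' − y). Then for every y' ∈ ℝⁿ, T₂(y') − FH₂(y') = ½·tr(C); in particular the two expansions agree up to an additive constant independent of y'. -/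

import Mathlib

open MeasureTheory Real Matrix
open scoped RealInnerProductSpace

attribute [local instance] Matrix.normedAddCommGroup Matrix.normedSpace

/-- The standard Gaussian measure on `ℝⁿ`, with density `(2π)^{−n/2} exp(−‖x‖²/2)` with
respect to Lebesgue measure. -/
noncomputable def stdGaussian (n : ℕ) : Measure (EuclideanSpace ℝ (Fin n)) :=
  volume.withDensity fun x =>
    ENNReal.ofReal ((2 * π) ^ (-(n : ℝ) / 2) * Real.exp (-‖x‖ ^ 2 / 2))

/-- A function has at most polynomial growth if `‖f(x)‖ ≤ C(1 + ‖x‖)^r` for some `C > 0`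
and some natural number `r`. -/
def PolyGrowth {E F : Type*} [NormedAddCommGroup E] [NormedAddCommGroup F] (f : E → F) : Prop :=
  ∃ C > (0 : ℝ), ∃ r : ℕ, ∀ x, ‖f x‖ ≤ C * (1 + ‖x‖) ^ r

/-- The Hessian matrix `(∇²g(x))_{ij} = ∂²g/∂xᵢ∂xⱼ (x)` of `g : ℝⁿ → ℝ`. -/
noncomputable def hessian {n : ℕ} (g : EuclideanSpace ℝ (Fin n) → ℝ)
    (x : EuclideanSpace ℝ (Fin n)) : Matrix (Fin n) (Fin n) ℝ :=
  Matrix.of fun i j =>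
    fderiv ℝ (fun z => fderiv ℝ g z (EuclideanSpace.single j 1)) x (EuclideanSpace.single i 1)

/-- Zeroth-order Fourier–Hermite coefficient `a = ∫ g(Λx + y) dγₙ(x)`. -/
noncomputable def fhA {n : ℕ} (g : EuclideanSpace ℝ (Fin n) → ℝ)
    (Λ : Matrix (Fin n) (Fin n) ℝ) (y : EuclideanSpace ℝ (Fin n)) : ℝ :=
  ∫ x, g (Matrix.toEuclideanLin Λ x + y) ∂(stdGaussian n)

/-- First-order Fourier–Hermite coefficient `b = ∫ g(Λx + y)·x dγₙ(x)`. -/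
noncomputable def fhB {n : ℕ} (g : EuclideanSpace ℝ (Fin n) → ℝ)
    (Λ : Matrix (Fin n) (Fin n) ℝ) (y : EuclideanSpace ℝ (Fin n)) :
    EuclideanSpace ℝ (Fin n) :=
  ∫ x, g (Matrix.toEuclideanLin Λ x + y) • x ∂(stdGaussian n)

/-- Second-order Fourier–Hermite coefficient `C = ∫ g(Λx + y)·(x xᵀ − I) dγₙ(x)`. -/
noncomputable def fhC {n : ℕ} (g : EuclideanSpace ℝ (Fin n) → ℝ)
    (Λ : Matrix (Fin n) (Fin n) ℝ) (y : EuclideanSpace ℝ (Fin n)) :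
    Matrix (Fin n) (Fin n) ℝ :=
  ∫ x, g (Matrix.toEuclideanLin Λ x + y) •
    ((Matrix.of fun i j => x i * x j) - (1 : Matrix (Fin n) (Fin n) ℝ)) ∂(stdGaussian n)

/-- The second-order Fourier–Hermite expansion
`FH₂(y') = a − ½·tr(C) + bᵀ Λ⁻¹(y' − y) + ½ (y' − y)ᵀ Λ^{−⊤} C Λ^{−1} (y' − y)`. -/
noncomputable def FH2 {n : ℕ} (g : EuclideanSpace ℝ (Fin n) → ℝ)
    (Λ : Matrix (Fin n) (Fin n) ℝ) (y y' : EuclideanSpace ℝ (Fin n)) : ℝ :=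
  fhA g Λ y - (1 / 2) * (fhC g Λ y).trace
    + ⟪fhB g Λ y, Matrix.toEuclideanLin Λ⁻¹ (y' - y)⟫
    + (1 / 2) * ⟪Matrix.toEuclideanLin Λ⁻¹ (y' - y),
        Matrix.toEuclideanLin (fhC g Λ y) (Matrix.toEuclideanLin Λ⁻¹ (y' - y))⟫

/-- The Weierstrass-type transform `ḡ(w) = ∫ g(w + Λx) dγₙ(x)`. -/
noncomputable def weierstrass {n : ℕ} (g : EuclideanSpace ℝ (Fin n) → ℝ)
    (Λ : Matrix (Fin n) (Fin n) ℝ) (w : EuclideanSpace ℝ (Fin n)) : ℝ :=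
  ∫ x, g (w + Matrix.toEuclideanLin Λ x) ∂(stdGaussian n)

/-- The second-order Taylor expansion of the Weierstrass transform `ḡ` at `y`:
`T₂(y') = ḡ(y) + ∇ḡ(y)ᵀ(y' − y) + ½ (y' − y)ᵀ ∇²ḡ(y) (y' − y)`. -/
noncomputable def taylor2 {n : ℕ} (g : EuclideanSpace ℝ (Fin n) → ℝ)
    (Λ : Matrix (Fin n) (Fin n) ℝ) (y y' : EuclideanSpace ℝ (Fin n)) : ℝ :=
  weierstrass g Λ y + ⟪gradient (weierstrass g Λ) y, y' - y⟫
    + (1 / 2) * ⟪y' - y, Matrix.toEuclideanLin (hessian (weierstrass g Λ) y) (y' - y)⟫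

namespace PolyGrowth

variable {E F G : Type*} [NormedAddCommGroup E] [NormedAddCommGroup F] [NormedAddCommGroup G]

theorem of_norm_le {f : E → F} {h : E → G} (hh : PolyGrowth h) {K : ℝ}
    (hle : ∀ x, ‖f x‖ ≤ K * ‖h x‖) : PolyGrowth f := by
  obtain ⟨C, hC, r, hr⟩ := hh
  refine ⟨(|K| + 1) * C, by positivity, r, fun x => (hle x).trans ?_⟩
  calc K * ‖h x‖ ≤ (|K| + 1) * (C * (1 + ‖x‖) ^ r) := by
        gcongr
        · linarith [le_abs_self K]
        · exact hr x
    _ = (|K| + 1) * C * (1 + ‖x‖) ^ r := by ring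

theorem const (c : F) : PolyGrowth (fun _ : E => c) :=
  ⟨‖c‖ + 1, by positivity, 0, fun _ => by simp⟩

theorem id : PolyGrowth (fun x : E => x) :=
  ⟨1, one_pos, 1, fun x => by simp⟩

theorem add {f h : E → F} (hf : PolyGrowth f) (hh : PolyGrowth h) :
    PolyGrowth (fun x => f x + h x) := by
  obtain ⟨C, hC, r, hr⟩ := hf
  obtain ⟨D, hD, s, hs⟩ := hh
  refine ⟨C + D, by positivity, r + s, fun x => ?_⟩
  have h1 : (1 : ℝ) ≤ 1 + ‖x‖ := by linarith [norm_nonneg x]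
  calc ‖f x + h x‖ ≤ C * (1 + ‖x‖) ^ r + D * (1 + ‖x‖) ^ s :=
        (norm_add_le _ _).trans (add_le_add (hr x) (hs x))
    _ ≤ C * (1 + ‖x‖) ^ (r + s) + D * (1 + ‖x‖) ^ (r + s) := by
        gcongr <;> first | exact h1 | omega
    _ = (C + D) * (1 + ‖x‖) ^ (r + s) := by ring

theorem smul [NormedSpace ℝ F] {f : E → ℝ} {h : E → F} (hf : PolyGrowth f) (hh : PolyGrowth h) :
    PolyGrowth (fun x => f x • h x) := by
  obtain ⟨C, hC, r, hr⟩ := hf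
  obtain ⟨D, hD, s, hs⟩ := hh
  refine ⟨C * D, by positivity, r + s, fun x => ?_⟩
  calc ‖f x • h x‖ ≤ (C * (1 + ‖x‖) ^ r) * (D * (1 + ‖x‖) ^ s) := by
        rw [norm_smul]
        gcongr
        · exact hr x
        · exact hs x
    _ = C * D * (1 + ‖x‖) ^ (r + s) := by ring

theorem mul {f h : E → ℝ} (hf : PolyGrowth f) (hh : PolyGrowth h) :
    PolyGrowth (fun x => f x * h x) :=
  hf.smul hh

theorem norm {f : E → F} (hf : PolyGrowth f) : PolyGrowth (fun x => ‖f x‖) :=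
  hf.of_norm_le (K := 1) fun x => by simp

theorem pow {f : E → ℝ} (hf : PolyGrowth f) (r : ℕ) : PolyGrowth (fun x => f x ^ r) := by
  induction r with
  | zero => simpa using const (E := E) (1 : ℝ)
  | succ k ih => simpa only [pow_succ] using ih.mul hf

theorem comp {f : F → G} {h : E → F} (hf : PolyGrowth f) (hh : PolyGrowth h) :
    PolyGrowth (fun x => f (h x)) := by
  obtain ⟨C, hC, r, hr⟩ := hf
  refine (((const (1 : ℝ)).add hh.norm).pow r).of_norm_le (K := C) fun x => ?_
  rw [Real.norm_of_nonneg (by positivity)]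
  exact hr (h x)

theorem clm [NormedSpace ℝ E] [NormedSpace ℝ F] (L : E →L[ℝ] F) : PolyGrowth (fun x => L x) :=
  id.of_norm_le (K := ‖L‖) L.le_opNorm

theorem clm_comp [NormedSpace ℝ F] [NormedSpace ℝ G] (L : F →L[ℝ] G) {f : E → F}
    (hf : PolyGrowth f) : PolyGrowth (fun x => L (f x)) :=
  hf.of_norm_le (K := ‖L‖) fun x => L.le_opNorm (f x)

theorem affine [NormedSpace ℝ E] [NormedSpace ℝ F] (w : F) (A : E →L[ℝ] F) :
    PolyGrowth (fun x => w + A x) :=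
  (const w).add (clm A)

end PolyGrowth

section Gaussian

variable {n : ℕ}

/-- The density `(2π)^{−n/2} exp(−‖x‖²/2)` of the standard Gaussian measure. -/
noncomputable def stdGaussianDensity (n : ℕ) (x : EuclideanSpace ℝ (Fin n)) : ℝ :=
  (2 * π) ^ (-(n : ℝ) / 2) * Real.exp (-‖x‖ ^ 2 / 2)

theorem stdGaussianDensity_nonneg (x : EuclideanSpace ℝ (Fin n)) :
    0 ≤ stdGaussianDensity n x := by
  unfold stdGaussianDensity; positivity

theorem continuous_stdGaussianDensity : Continuous (stdGaussianDensity n) := by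
  unfold stdGaussianDensity; fun_prop

theorem hasFDerivAt_stdGaussianDensity (x : EuclideanSpace ℝ (Fin n)) :
    HasFDerivAt (stdGaussianDensity n) (-stdGaussianDensity n x • innerSL ℝ x) x := by
  have h := ((((hasStrictFDerivAt_norm_sq x).hasFDerivAt.neg.mul_const (2⁻¹ : ℝ)).exp).const_mul
    ((2 * π) ^ (-(n : ℝ) / 2)))
  refine (h.congr_fderiv ?_).congr_of_eventuallyEq (.of_forall fun z => ?_)
  · ext v
    simp [stdGaussianDensity, div_eq_mul_inv]
    ring
  · simp [stdGaussianDensity, div_eq_mul_inv]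

theorem stdGaussian_eq_withDensity :
    stdGaussian n = volume.withDensity fun x => ENNReal.ofReal (stdGaussianDensity n x) :=
  rfl

theorem integrable_stdGaussian_iff {F : Type*} [NormedAddCommGroup F] [NormedSpace ℝ F]
    {f : EuclideanSpace ℝ (Fin n) → F} :
    Integrable f (stdGaussian n) ↔ Integrable (fun x => stdGaussianDensity n x • f x) := by
  have := integrable_withDensity_iff_integrable_smul' (μ := volume) (g := f)
    (continuous_stdGaussianDensity (n := n)).measurable.ennreal_ofReal
    (.of_forall fun _ => ENNReal.ofReal_lt_top)
  simpa only [stdGaussian_eq_withDensity,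
    ENNReal.toReal_ofReal (stdGaussianDensity_nonneg _)] using this

theorem integral_stdGaussian {F : Type*} [NormedAddCommGroup F] [NormedSpace ℝ F]
    (f : EuclideanSpace ℝ (Fin n) → F) :
    ∫ x, f x ∂(stdGaussian n) = ∫ x, stdGaussianDensity n x • f x := by
  have := integral_withDensity_eq_integral_toReal_smul (μ := volume)
    (continuous_stdGaussianDensity (n := n)).measurable.ennreal_ofReal
    (.of_forall fun _ => ENNReal.ofReal_lt_top) f
  simpa only [stdGaussian_eq_withDensity,
    ENNReal.toReal_ofReal (stdGaussianDensity_nonneg _)] using this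

theorem integrable_exp_neg_mul_norm_sq {b : ℝ} (hb : 0 < b) :
    Integrable fun x : EuclideanSpace ℝ (Fin n) => Real.exp (-b * ‖x‖ ^ 2) := by
  have h := (GaussianFourier.integrable_cexp_neg_mul_sq_norm_add (b := (b : ℂ)) (by simpa using hb)
    0 (0 : EuclideanSpace ℝ (Fin n))).norm
  refine h.congr (.of_forall fun x => ?_)
  simp [Complex.norm_exp, ← Complex.ofReal_pow]

theorem PolyGrowth.integrable_stdGaussian {F : Type*} [NormedAddCommGroup F] [NormedSpace ℝ F]
    {f : EuclideanSpace ℝ (Fin n) → F} (hf : PolyGrowth f) (hc : Continuous f) :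
    Integrable f (stdGaussian n) := by
  obtain ⟨C, hC, r, hr⟩ := hf
  rw [integrable_stdGaussian_iff]
  refine ((integrable_exp_neg_mul_norm_sq (n := n) (b := 1 / 4) (by norm_num)).const_mul
    ((2 * π) ^ (-(n : ℝ) / 2) * C * r.factorial * Real.exp 2)).mono'
    (continuous_stdGaussianDensity.smul hc).aestronglyMeasurable (.of_forall fun x => ?_)
  have h1 : (1 + ‖x‖) ^ r ≤ r.factorial * Real.exp (1 + ‖x‖) := by
    have := Real.pow_div_factorial_le_exp (1 + ‖x‖) (by positivity) r
    rwa [div_le_iff₀' (by positivity)] at this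
  have h2 : Real.exp (-‖x‖ ^ 2 / 2) * Real.exp (1 + ‖x‖)
      ≤ Real.exp 2 * Real.exp (-(1 / 4) * ‖x‖ ^ 2) := by
    rw [← Real.exp_add, ← Real.exp_add, Real.exp_le_exp]
    nlinarith [sq_nonneg (‖x‖ - 2)]
  rw [norm_smul, Real.norm_of_nonneg (stdGaussianDensity_nonneg x)]
  unfold stdGaussianDensity
  calc _ ≤ (2 * π) ^ (-(n : ℝ) / 2) * Real.exp (-‖x‖ ^ 2 / 2)
        * (C * (r.factorial * Real.exp (1 + ‖x‖))) := by
        gcongr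
        exact (hr x).trans (by gcongr)
    _ = (2 * π) ^ (-(n : ℝ) / 2) * C * r.factorial
        * (Real.exp (-‖x‖ ^ 2 / 2) * Real.exp (1 + ‖x‖)) := by ring
    _ ≤ (2 * π) ^ (-(n : ℝ) / 2) * C * r.factorial
        * (Real.exp 2 * Real.exp (-(1 / 4) * ‖x‖ ^ 2)) := by gcongr
    _ = _ := by ring

theorem PolyGrowth.map_integral_stdGaussian {F : Type*} [NormedAddCommGroup F] [NormedSpace ℝ F]
    [FiniteDimensional ℝ F] {f : EuclideanSpace ℝ (Fin n) → F} (hf : PolyGrowth f)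
    (hc : Continuous f) (L : F →ₗ[ℝ] ℝ) :
    L (∫ x, f x ∂(stdGaussian n)) = ∫ x, L (f x) ∂(stdGaussian n) :=
  have := FiniteDimensional.complete ℝ F
  ((LinearMap.toContinuousLinearMap L).integral_comp_comm (hf.integrable_stdGaussian hc)).symm

/-- Gaussian integration by parts (Stein's identity). -/
theorem integral_fderiv_stdGaussian {h : EuclideanSpace ℝ (Fin n) → ℝ} (hh : ContDiff ℝ 1 h)
    (hgrow : PolyGrowth h) (hgrow' : PolyGrowth (fderiv ℝ h)) (u : EuclideanSpace ℝ (Fin n)) :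
    ∫ x, fderiv ℝ h x u ∂(stdGaussian n) = ∫ x, h x * ⟪x, u⟫ ∂(stdGaussian n) := by
  have hd : ∀ x : EuclideanSpace ℝ (Fin n),
      fderiv ℝ (stdGaussianDensity n) x u = -(stdGaussianDensity n x * ⟪x, u⟫) := fun x => by
    simp [(hasFDerivAt_stdGaussianDensity x).fderiv]
  have hcont' : Continuous (fderiv ℝ h) := hh.continuous_fderiv one_ne_zero
  have hinner : PolyGrowth fun x : EuclideanSpace ℝ (Fin n) => ⟪x, u⟫ := by
    simpa only [innerSL_apply_apply, real_inner_comm] using PolyGrowth.clm (innerSL ℝ u)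
  have i1 := integrable_stdGaussian_iff.1
    ((hgrow'.clm_comp (ContinuousLinearMap.apply ℝ ℝ u)).integrable_stdGaussian (by fun_prop))
  have i2 := integrable_stdGaussian_iff.1
    ((hgrow.mul hinner).integrable_stdGaussian (hh.continuous.mul (by fun_prop)))
  have i3 := integrable_stdGaussian_iff.1 (hgrow.integrable_stdGaussian hh.continuous)
  have key := integral_mul_fderiv_eq_neg_fderiv_mul_of_integrable (μ := volume)
    (f := stdGaussianDensity n) (g := h) (v := u)
    (i2.neg.congr (.of_forall fun x => by simp [hd]; ring)) i1 i3
    (fun x _ => (hasFDerivAt_stdGaussianDensity x).differentiableAt)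
    (fun x _ => hh.differentiable one_ne_zero x)
  rw [integral_stdGaussian, integral_stdGaussian]
  simp only [smul_eq_mul]
  rw [key, ← integral_neg]
  congr 1 with x
  rw [hd]
  ring

theorem fderiv_comp_affine {h : EuclideanSpace ℝ (Fin n) → ℝ} (hh : Differentiable ℝ h)
    (A : EuclideanSpace ℝ (Fin n) →L[ℝ] EuclideanSpace ℝ (Fin n))
    (w x : EuclideanSpace ℝ (Fin n)) :
    fderiv ℝ (fun z => h (w + A z)) x = (fderiv ℝ h (w + A x)).comp A :=
  ((hh (w + A x)).hasFDerivAt.comp x (A.hasFDerivAt.const_add w)).fderiv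

theorem PolyGrowth.fderiv_comp_affine {h : EuclideanSpace ℝ (Fin n) → ℝ}
    (hh : Differentiable ℝ h) (hgrow' : PolyGrowth (fderiv ℝ h))
    (A : EuclideanSpace ℝ (Fin n) →L[ℝ] EuclideanSpace ℝ (Fin n))
    (w : EuclideanSpace ℝ (Fin n)) : PolyGrowth (fderiv ℝ fun z => h (w + A z)) := by
  refine (hgrow'.comp (affine w A)).of_norm_le (K := ‖A‖) fun x => ?_
  rw [_root_.fderiv_comp_affine hh, mul_comm]
  exact ContinuousLinearMap.opNorm_comp_le _ _

/-- Stein's identity for the Gaussian law with mean `w` and covariance `A Aᵀ`. -/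
theorem integral_fderiv_affine_stdGaussian {h : EuclideanSpace ℝ (Fin n) → ℝ}
    (hh : ContDiff ℝ 1 h) (hgrow : PolyGrowth h) (hgrow' : PolyGrowth (fderiv ℝ h))
    (A : EuclideanSpace ℝ (Fin n) →L[ℝ] EuclideanSpace ℝ (Fin n))
    (w u : EuclideanSpace ℝ (Fin n)) :
    ∫ x, fderiv ℝ h (w + A x) (A u) ∂(stdGaussian n)
      = ∫ x, h (w + A x) * ⟪x, u⟫ ∂(stdGaussian n) := by
  have hd := hh.differentiable one_ne_zero
  have := integral_fderiv_stdGaussian (h := fun x => h (w + A x)) (by fun_prop)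
    (hgrow.comp (.affine w A)) (hgrow'.fderiv_comp_affine hd A w) u
  simpa only [fderiv_comp_affine hd, ContinuousLinearMap.comp_apply] using this

theorem integral_fderiv_affine_mul_inner_stdGaussian {h : EuclideanSpace ℝ (Fin n) → ℝ}
    (hh : ContDiff ℝ 1 h) (hgrow : PolyGrowth h) (hgrow' : PolyGrowth (fderiv ℝ h))
    (A : EuclideanSpace ℝ (Fin n) →L[ℝ] EuclideanSpace ℝ (Fin n))
    (w u v : EuclideanSpace ℝ (Fin n)) :
    ∫ x, fderiv ℝ h (w + A x) (A v) * ⟪x, u⟫ ∂(stdGaussian n)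
      = ∫ x, h (w + A x) * (⟪x, u⟫ * ⟪x, v⟫ - ⟪u, v⟫) ∂(stdGaussian n) := by
  have hd := hh.differentiable one_ne_zero
  have hcont' : Continuous (fderiv ℝ h) := hh.continuous_fderiv one_ne_zero
  have hk : ContDiff ℝ 1 fun x => h (w + A x) := by fun_prop
  have hkg := hgrow.comp (PolyGrowth.affine w A)
  have hkg' := hgrow'.fderiv_comp_affine hd A w
  have hin : ∀ v : EuclideanSpace ℝ (Fin n),
      PolyGrowth fun x : EuclideanSpace ℝ (Fin n) => ⟪x, v⟫ :=
    fun v => by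
      simpa only [innerSL_apply_apply, real_inner_comm] using PolyGrowth.clm (innerSL ℝ v)
  have hD : ∀ x, HasFDerivAt (fun x => h (w + A x) * innerSL ℝ u x)
      (h (w + A x) • innerSL ℝ u + innerSL ℝ u x • fderiv ℝ (fun z => h (w + A z)) x) x :=
    fun x => (hk.differentiable one_ne_zero x).hasFDerivAt.mul (innerSL ℝ u).hasFDerivAt
  have hDg : PolyGrowth (fderiv ℝ fun x => h (w + A x) * innerSL ℝ u x) := by
    rw [funext fun x => (hD x).fderiv]
    exact (hkg.smul (.const _)).add ((PolyGrowth.clm _).smul hkg')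
  have key := integral_fderiv_stdGaussian
    (hk.mul (innerSL ℝ u).contDiff) (hkg.mul (.clm (innerSL ℝ u))) hDg v
  simp only [(hD _).fderiv] at key
  simp only [fderiv_comp_affine hd, _root_.add_apply, _root_.smul_apply, innerSL_apply_apply,
    ContinuousLinearMap.comp_apply,
    smul_eq_mul] at key
  have i1 : Integrable (fun x => h (w + A x) * ⟪u, v⟫) (stdGaussian n) :=
    (hkg.mul (.const _)).integrable_stdGaussian (hk.continuous.mul continuous_const)
  have i2 : Integrable (fun x => ⟪u, x⟫ * fderiv ℝ h (w + A x) (A v)) (stdGaussian n) := by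
    have := (hin u).mul ((hgrow'.comp (.affine w A)).clm_comp (ContinuousLinearMap.apply ℝ ℝ (A v)))
    simp only [real_inner_comm] at this
    exact this.integrable_stdGaussian (by fun_prop)
  have i3 : Integrable (fun x => h (w + A x) * ⟪u, x⟫ * ⟪x, v⟫) (stdGaussian n) := by
    have := ((hkg.mul (hin u)).mul (hin v))
    simp only [real_inner_comm] at this ⊢
    exact this.integrable_stdGaussian (by have := hk.continuous; fun_prop)
  rw [integral_add i1 i2] at key
  calc _ = ∫ x, ⟪u, x⟫ * fderiv ℝ h (w + A x) (A v) ∂(stdGaussian n) := by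
        simp only [real_inner_comm, mul_comm]
    _ = ∫ x, h (w + A x) * ⟪u, x⟫ * ⟪x, v⟫ ∂(stdGaussian n)
        - ∫ x, h (w + A x) * ⟪u, v⟫ ∂(stdGaussian n) := by rw [← key]; ring
    _ = _ := by
        rw [← integral_sub i3 i1]
        congr 1 with x
        rw [real_inner_comm x u]
        ring

theorem hasFDerivAt_integral_affine_stdGaussian {h : EuclideanSpace ℝ (Fin n) → ℝ}
    (hh : ContDiff ℝ 1 h) (hgrow : PolyGrowth h) (hgrow' : PolyGrowth (fderiv ℝ h))
    (A : EuclideanSpace ℝ (Fin n) →L[ℝ] EuclideanSpace ℝ (Fin n))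
    (w : EuclideanSpace ℝ (Fin n)) :
    HasFDerivAt (fun w => ∫ x, h (w + A x) ∂(stdGaussian n))
      (∫ x, fderiv ℝ h (w + A x) ∂(stdGaussian n)) w := by
  have hcont' : Continuous (fderiv ℝ h) := hh.continuous_fderiv one_ne_zero
  have hcont := hh.continuous
  obtain ⟨C, hC, r, hr⟩ := hgrow'
  have hb : PolyGrowth fun x => C * (1 + (‖w‖ + 1 + ‖A x‖)) ^ r :=
    (PolyGrowth.const C).mul
      (((PolyGrowth.const 1).add ((PolyGrowth.const (‖w‖ + 1)).add (PolyGrowth.clm A).norm)).pow r)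
  refine hasFDerivAt_integral_of_dominated_of_fderiv_le
    (F := fun w x => h (w + A x)) (F' := fun w x => fderiv ℝ h (w + A x))
    (bound := fun x => C * (1 + (‖w‖ + 1 + ‖A x‖)) ^ r) (Metric.ball_mem_nhds w one_pos)
    (.of_forall fun z => Continuous.aestronglyMeasurable (by fun_prop))
    ((hgrow.comp (.affine w A)).integrable_stdGaussian (by fun_prop))
    (Continuous.aestronglyMeasurable (by fun_prop))
    (.of_forall fun x z hz => (hr _).trans ?_)
    (hb.integrable_stdGaussian (by fun_prop))
    (.of_forall fun x z _ => ?_)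
  · have hz' : ‖z‖ ≤ ‖w‖ + 1 := by
      have h1 : ‖z - w‖ < 1 := by simpa [dist_eq_norm] using hz
      linarith [norm_le_norm_add_norm_sub' z w]
    gcongr
    exact (norm_add_le _ _).trans (by gcongr)
  · exact (hh.differentiable one_ne_zero (z + A x)).hasFDerivAt.comp z
      ((hasFDerivAt_id z).add_const (A x)) |>.congr_fderiv (by ext; simp)

theorem fderiv_weierstrass_apply {h : EuclideanSpace ℝ (Fin n) → ℝ}
    (hh : ContDiff ℝ 1 h) (hgrow : PolyGrowth h) (hgrow' : PolyGrowth (fderiv ℝ h))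
    (Λ : Matrix (Fin n) (Fin n) ℝ) (w v : EuclideanSpace ℝ (Fin n)) :
    fderiv ℝ (weierstrass h Λ) w v = weierstrass (fun z => fderiv ℝ h z v) Λ w := by
  have hcont' : Continuous (fderiv ℝ h) := hh.continuous_fderiv one_ne_zero
  have H := hasFDerivAt_integral_affine_stdGaussian hh hgrow hgrow'
    (LinearMap.toContinuousLinearMap (Matrix.toEuclideanLin Λ)) w
  have i : Integrable (fun x => fderiv ℝ h
      (w + LinearMap.toContinuousLinearMap (Matrix.toEuclideanLin Λ) x)) (stdGaussian n) :=
    (hgrow'.comp (.affine w _)).integrable_stdGaussian (by fun_prop)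
  have e : fderiv ℝ (weierstrass h Λ) w = _ := H.fderiv
  rw [e, ContinuousLinearMap.integral_apply i]
  rfl

theorem PolyGrowth.fderiv_of_gradient {g : EuclideanSpace ℝ (Fin n) → ℝ}
    (h : PolyGrowth (gradient g)) : PolyGrowth (fderiv ℝ g) :=
  h.of_norm_le (K := 1) fun x => by simp [gradient]

theorem PolyGrowth.fderiv_partial_of_hessian {g : EuclideanSpace ℝ (Fin n) → ℝ}
    (h : PolyGrowth (hessian g)) (j : Fin n) :
    PolyGrowth (fderiv ℝ fun z => fderiv ℝ g z (EuclideanSpace.single j 1)) := by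
  refine h.of_norm_le (K := n) fun x => ?_
  refine ContinuousLinearMap.opNorm_le_bound _ (by positivity) fun v => ?_
  have hv : v = ∑ i, v i • EuclideanSpace.single i (1 : ℝ) := by
    simpa using ((EuclideanSpace.basisFun (Fin n) ℝ).sum_repr v).symm
  conv_lhs => rw [hv]
  rw [map_sum]
  refine (norm_sum_le _ _).trans ?_
  calc _ ≤ ∑ _i : Fin n, ‖v‖ * ‖hessian g x‖ := by
        gcongr with i
        rw [map_smul, norm_smul]
        gcongr
        · exact PiLp.norm_apply_le v i
        · exact Matrix.norm_entry_le_entrywise_sup_norm (hessian g x) (i := i) (j := j)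
    _ = _ := by simp; ring

theorem inner_fhB {g : EuclideanSpace ℝ (Fin n) → ℝ} (hc : Continuous g) (hgrow : PolyGrowth g)
    (Λ : Matrix (Fin n) (Fin n) ℝ) (y u : EuclideanSpace ℝ (Fin n)) :
    ⟪fhB g Λ y, u⟫
      = ∫ x, g (y + LinearMap.toContinuousLinearMap (Matrix.toEuclideanLin Λ) x) * ⟪x, u⟫
          ∂(stdGaussian n) := by
  set A := LinearMap.toContinuousLinearMap (Matrix.toEuclideanLin Λ)
  have i : Integrable (fun x => g (y + A x) • x) (stdGaussian n) :=
    ((hgrow.comp (.affine y A)).smul .id).integrable_stdGaussian (by fun_prop)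
  have e : fhB g Λ y = ∫ x, g (y + A x) • x ∂(stdGaussian n) := by
    simp only [fhB, add_comm y]; rfl
  rw [e, real_inner_comm, ← integral_inner i]
  simp only [real_inner_smul_right, real_inner_comm]

theorem inner_fhC {g : EuclideanSpace ℝ (Fin n) → ℝ} (hc : Continuous g) (hgrow : PolyGrowth g)
    (Λ : Matrix (Fin n) (Fin n) ℝ) (y u v : EuclideanSpace ℝ (Fin n)) :
    ⟪u, Matrix.toEuclideanLin (fhC g Λ y) v⟫
      = ∫ x, g (y + LinearMap.toContinuousLinearMap (Matrix.toEuclideanLin Λ) x)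
          * (⟪x, u⟫ * ⟪x, v⟫ - ⟪u, v⟫) ∂(stdGaussian n) := by
  set A := LinearMap.toContinuousLinearMap (Matrix.toEuclideanLin Λ)
  let H : EuclideanSpace ℝ (Fin n) → Matrix (Fin n) (Fin n) ℝ := fun x =>
    (Matrix.of fun i j => x i * x j) - (1 : Matrix (Fin n) (Fin n) ℝ)
  have hHc : Continuous H := by
    refine Continuous.sub (continuous_matrix fun i j => ?_) continuous_const
    simp only [Matrix.of_apply]
    fun_prop
  have hsq : PolyGrowth fun x : EuclideanSpace ℝ (Fin n) =>
      (Matrix.of fun i j => x i * x j : Matrix (Fin n) (Fin n) ℝ) := by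
    refine (PolyGrowth.id.norm.pow 2).of_norm_le (K := 1) fun x => ?_
    rw [Matrix.norm_le_iff (by positivity)]
    intro i j
    simp only [Matrix.of_apply, norm_mul, norm_norm, one_mul, sq]
    gcongr <;> exact PiLp.norm_apply_le x _
  have hHg : PolyGrowth H := by
    simpa only [H, sub_eq_add_neg] using hsq.add (.const (-1))
  have e : fhC g Λ y = ∫ x, g (y + A x) • H x ∂(stdGaussian n) := by
    simp only [fhC, add_comm y]; rfl
  let L : Matrix (Fin n) (Fin n) ℝ →ₗ[ℝ] ℝ :=
    (innerₛₗ ℝ u).comp ((LinearMap.applyₗ v).comp (Matrix.toEuclideanLin (𝕜 := ℝ)).toLinearMap)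
  have hL : ∀ M, L M = ⟪u, Matrix.toEuclideanLin M v⟫ := fun M => rfl
  have hcA : Continuous fun x => g (y + A x) := by fun_prop
  rw [← hL, e, ((hgrow.comp (.affine y A)).smul hHg).map_integral_stdGaussian (hcA.smul hHc)]
  congr 1 with x
  rw [map_smul, hL, smul_eq_mul]
  congr 1
  have h1 : Matrix.toEuclideanLin (H x) v = ⟪x, v⟫ • x - v := by
    ext k
    simp [H, Matrix.toLpLin_apply, Matrix.mulVec, dotProduct, PiLp.inner_apply,
      Finset.sum_mul]
    exact Finset.sum_congr rfl fun _ _ => by ring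
  rw [h1, inner_sub_right, real_inner_smul_right, real_inner_comm u x]
  ring

theorem inner_gradient_weierstrass {g : EuclideanSpace ℝ (Fin n) → ℝ} (hg : ContDiff ℝ 1 g)
    (hgrow : PolyGrowth g) (hgrow' : PolyGrowth (fderiv ℝ g))
    {Λ : Matrix (Fin n) (Fin n) ℝ} (y u : EuclideanSpace ℝ (Fin n)) :
    ⟪gradient (weierstrass g Λ) y, Matrix.toEuclideanLin Λ u⟫ = ⟪fhB g Λ y, u⟫ := by
  rw [inner_fhB hg.continuous hgrow, gradient, InnerProductSpace.toDual_symm_apply,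
    fderiv_weierstrass_apply hg hgrow hgrow']
  exact integral_fderiv_affine_stdGaussian hg hgrow hgrow'
    (LinearMap.toContinuousLinearMap (Matrix.toEuclideanLin Λ)) y u

theorem hessian_weierstrass_apply {g : EuclideanSpace ℝ (Fin n) → ℝ} (hg : ContDiff ℝ 2 g)
    (hgrow : PolyGrowth g) (hgrow' : PolyGrowth (fderiv ℝ g)) (hgrow'' : PolyGrowth (hessian g))
    {Λ : Matrix (Fin n) (Fin n) ℝ} (y : EuclideanSpace ℝ (Fin n)) {i j : Fin n}
    {u v : EuclideanSpace ℝ (Fin n)} (hu : Matrix.toEuclideanLin Λ u = EuclideanSpace.single i 1)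
    (hv : Matrix.toEuclideanLin Λ v = EuclideanSpace.single j 1) :
    hessian (weierstrass g Λ) y i j = ⟪u, Matrix.toEuclideanLin (fhC g Λ y) v⟫ := by
  have hg1 : ContDiff ℝ 1 g := hg.of_le one_le_two
  have hp : ContDiff ℝ 1 fun z => fderiv ℝ g z (EuclideanSpace.single j 1) :=
    (hg.fderiv_right (m := 1) (by norm_num)).clm_apply contDiff_const
  have hpg : PolyGrowth fun z => fderiv ℝ g z (EuclideanSpace.single j 1) :=
    hgrow'.clm_comp (ContinuousLinearMap.apply ℝ ℝ (EuclideanSpace.single j 1))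
  have hpg' := hgrow''.fderiv_partial_of_hessian j
  simp only [hessian, Matrix.of_apply, fderiv_weierstrass_apply hg1 hgrow hgrow',
    fderiv_weierstrass_apply hp hpg hpg']
  rw [inner_fhC hg.continuous hgrow,
    ← integral_fderiv_affine_mul_inner_stdGaussian hg1 hgrow hgrow']
  have key := integral_fderiv_affine_stdGaussian hp hpg hpg'
    (LinearMap.toContinuousLinearMap (Matrix.toEuclideanLin Λ)) y u
  simp only [LinearMap.coe_toContinuousLinearMap', hu, hv] at key ⊢
  exact key

theorem inner_hessian_weierstrass {g : EuclideanSpace ℝ (Fin n) → ℝ} (hg : ContDiff ℝ 2 g)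
    (hgrow : PolyGrowth g) (hgrow' : PolyGrowth (fderiv ℝ g)) (hgrow'' : PolyGrowth (hessian g))
    {Λ : Matrix (Fin n) (Fin n) ℝ} (hΛ : IsUnit Λ.det) (y v : EuclideanSpace ℝ (Fin n)) :
    ⟪v, Matrix.toEuclideanLin (hessian (weierstrass g Λ) y) v⟫
      = ⟪Matrix.toEuclideanLin Λ⁻¹ v,
          Matrix.toEuclideanLin (fhC g Λ y) (Matrix.toEuclideanLin Λ⁻¹ v)⟫ := by
  have hinv : ∀ w, Matrix.toEuclideanLin Λ (Matrix.toEuclideanLin Λ⁻¹ w) = w := fun w => by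
    simp [Matrix.toLpLin_apply, Matrix.mul_nonsing_inv Λ hΛ]
  have hv : v = ∑ i, v i • EuclideanSpace.single i (1 : ℝ) := by
    simpa using ((EuclideanSpace.basisFun (Fin n) ℝ).sum_repr v).symm
  conv_rhs => rw [hv]
  simp only [map_sum, map_smul, sum_inner, inner_sum, real_inner_smul_left, real_inner_smul_right,
    ← hessian_weierstrass_apply hg hgrow hgrow' hgrow'' y (hinv _) (hinv _)]
  simp only [PiLp.inner_apply, Matrix.toLpLin_apply, Matrix.mulVec, dotProduct,
    RCLike.inner_apply, conj_trivial, Finset.sum_mul]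
  rw [Finset.sum_comm]
  exact Finset.sum_congr rfl fun _ _ => Finset.sum_congr rfl fun _ _ => by ring

end Gaussian

/-- Relationship of Taylor and Fourier–Hermite series: the second-order Taylor expansion
of the Weierstrass transform `ḡ` at `y` and the second-order Fourier–Hermite expansion of
`g` with respect to `N(y, ΛΛᵀ)` differ by the constant `½·tr(C)`, independent of `y'`. -/
theorem taylor_eq_fourierHermite_up_to_constant (n : ℕ)
    (g : EuclideanSpace ℝ (Fin n) → ℝ) (hg : ContDiff ℝ 2 g)
    (hgc : Continuous g) (hgradc : Continuous (gradient g)) (hhessc : Continuous (hessian g))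
    (hgrow : PolyGrowth g) (hgrow' : PolyGrowth (gradient g)) (hgrow'' : PolyGrowth (hessian g))
    (Λ : Matrix (Fin n) (Fin n) ℝ) (hΛ : IsUnit Λ.det) (y : EuclideanSpace ℝ (Fin n)) :
    ∀ y' : EuclideanSpace ℝ (Fin n),
      taylor2 g Λ y y' - FH2 g Λ y y' = (1 / 2) * (fhC g Λ y).trace := by
  intro y'
  have hgrad := hgrow'.fderiv_of_gradient
  have hinv : Matrix.toEuclideanLin Λ (Matrix.toEuclideanLin Λ⁻¹ (y' - y)) = y' - y := by
    simp [Matrix.toLpLin_apply, Matrix.mul_nonsing_inv Λ hΛ]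
  have h0 : weierstrass g Λ y = fhA g Λ y := by
    simp only [weierstrass, fhA, add_comm y]
  have h1 := inner_gradient_weierstrass (Λ := Λ) (hg.of_le one_le_two) hgrow hgrad y
    (Matrix.toEuclideanLin Λ⁻¹ (y' - y))
  rw [hinv] at h1
  rw [taylor2, FH2, h0, h1, inner_hessian_weierstrass hg hgrow hgrad hgrow'' hΛ]
  ring
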